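/- Let q ≥ 3 be a power of an odd prime, let m ≥ 8 with m ≡ 2 (mod 3), and n = (q^m−1)/2. For 1 ≤ i ≤ 7, let δ_i′ be the i-th largest odd q-cyclotomic coset leader modulo 2n. Then the negacyclic BCH code C_{(n,−1,(δ_i′+1)/2,0)} over F_q has dimension exactly i·m; equivalently, the number of odd s ∈ {1,…,2n−1} lying outside ∪_{t=1}^{δ_i′−2} C_t^{2n} equals i·m. -/

import Mathlib

open Finset

/-- The `q`-cyclotomic coset of `i` modulo `N`, as a subset of `ZMod N`. -/
def qCoset (q N i : ℕ) : Set (ZMod N) :=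
  Set.range fun j : ℕ => (i : ZMod N) * (q : ZMod N) ^ j

/-- The odd `q`-cyclotomic coset leaders modulo `N`. -/
noncomputable def oddLeaders (q N : ℕ) : Finset ℕ := by
  classical
  exact (Finset.range N).filter fun s => Odd s ∧ ∀ j : ℕ, s ≤ (s * q ^ j) % N

/-- `x` is the `i`-th largest element of the finite set `S` (1-indexed). -/
def IsIthLargest (S : Finset ℕ) (i x : ℕ) : Prop :=
  x ∈ S ∧ (S.filter fun y => x ≤ y).card = i

/-- Evaluation of the polynomial with coefficient vector `c` at the point `x`
of an extension field. -/
noncomputable def evalAt (F : Type*) {E : Type*} [Field F] [Field E] [Algebra F E]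
    (n : ℕ) (x : E) : (Fin n → F) →ₗ[F] E where
  toFun c := ∑ j : Fin n, c j • x ^ (j : ℕ)
  map_add' a b := by simp [add_smul, Finset.sum_add_distrib]
  map_smul' r a := by simp [Finset.smul_sum, smul_smul]

/-- The negacyclic BCH code `C_(n,-1,δ,b)`: all words whose polynomial vanishes at
`γ^(1+2i)` for `b ≤ i ≤ b+δ-2`, where `γ` is a primitive `2n`-th root of unity. -/
noncomputable def negaBCH (F : Type*) {E : Type*} [Field F] [Field E] [Algebra F E]
    (n : ℕ) (γ : E) (δ b : ℕ) : Submodule F (Fin n → F) :=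
  ⨅ i ∈ Finset.Icc b (b + δ - 2), LinearMap.ker (evalAt F n (γ ^ (1 + 2 * i)))

/-- The cyclic BCH code `C_(n,1,δ,b)`: all words whose polynomial vanishes at
`β^i` for `b ≤ i ≤ b+δ-2`, where `β` is a primitive `n`-th root of unity. -/
noncomputable def cyclicBCH (F : Type*) {E : Type*} [Field F] [Field E] [Algebra F E]
    (n : ℕ) (β : E) (δ b : ℕ) : Submodule F (Fin n → F) :=
  ⨅ i ∈ Finset.Icc b (b + δ - 2), LinearMap.ker (evalAt F n (β ^ i))

/-- The dual code under the standard inner product. -/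
def dualCode {F : Type*} [Field F] {n : ℕ} (C : Submodule F (Fin n → F)) :
    Submodule F (Fin n → F) where
  carrier := {y | ∀ c ∈ C, ∑ j, y j * c j = 0}
  add_mem' := by
    intro a b ha hb c hc
    simp only [Set.mem_setOf_eq] at *
    simp [Pi.add_apply, add_mul, Finset.sum_add_distrib, ha c hc, hb c hc]
  zero_mem' := by intro c hc; simp
  smul_mem' := by
    intro r y hy c hc
    simp only [Set.mem_setOf_eq] at *
    simp [Pi.smul_apply, smul_eq_mul, mul_assoc, ← Finset.mul_sum, hy c hc]

/-- The extended code of a code of length `n`. -/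
def extendedCode {F : Type*} [Field F] {n : ℕ} (C : Submodule F (Fin n → F)) :
    Submodule F (Fin (n + 1) → F) where
  carrier := {x | (fun j : Fin n => x j.castSucc) ∈ C ∧ ∑ i, x i = 0}
  add_mem' := by
    intro a b ha hb
    exact ⟨C.add_mem ha.1 hb.1, by simp [Finset.sum_add_distrib, ha.2, hb.2]⟩
  zero_mem' := ⟨C.zero_mem, by simp⟩
  smul_mem' := by
    intro r x hx
    exact ⟨C.smul_mem r hx.1, by simp [← Finset.mul_sum, hx.2]⟩

/-- Hamming weight of a word. -/
noncomputable def hWt {F : Type*} [Field F] {n : ℕ} (c : Fin n → F) : ℕ := by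
  classical exact hammingNorm c

/-- `d` is the minimum Hamming distance of the code `C`. -/
def minDistIs {F : Type*} [Field F] {n : ℕ} (C : Submodule F (Fin n → F)) (d : ℕ) : Prop :=
  IsLeast {w : ℕ | ∃ c ∈ C, c ≠ 0 ∧ hWt c = w} d


theorem mem_oddLeaders {q N s : ℕ} :
    s ∈ oddLeaders q N ↔ s < N ∧ Odd s ∧ ∀ j : ℕ, s ≤ (s * q ^ j) % N := by
  simp [oddLeaders]

theorem pow_mul_modEq_one {q m N : ℕ} (hN : N + 1 = q ^ m) (a : ℕ) :
    q ^ (m * a) ≡ 1 [MOD N] := by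
  rw [pow_mul, ← hN]
  have h : N + 1 ≡ 1 [MOD N] := by simp [Nat.ModEq]
  simpa using h.pow a

theorem pow_modEq_pow_mod {q m N : ℕ} (hN : N + 1 = q ^ m) (j : ℕ) :
    q ^ j ≡ q ^ (j % m) [MOD N] := by
  conv_lhs => rw [← Nat.mod_add_div j m, pow_add]
  simpa using (Nat.ModEq.refl (q ^ (j % m))).mul (pow_mul_modEq_one hN (j / m))

/-- Multiplication by a power of `q` can be undone modulo `q ^ m - 1`. -/
theorem modEq_mul_pow_of_mul_pow_modEq {q m N x y a : ℕ} (hm : 1 ≤ m) (hN : N + 1 = q ^ m)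
    (h : x * q ^ a ≡ y [MOD N]) : x ≡ y * q ^ ((m - 1) * a) [MOD N] := by
  have h1 := h.mul_right (q ^ ((m - 1) * a))
  have h2 : x * q ^ a * q ^ ((m - 1) * a) = x * q ^ (m * a) := by
    rw [mul_assoc, ← pow_add]
    congr 2
    obtain ⟨m, rfl⟩ := Nat.exists_eq_add_of_le' hm
    simp
    ring
  rw [h2] at h1
  have h3 := (Nat.ModEq.refl x).mul (pow_mul_modEq_one hN a)
  rw [mul_one] at h3
  exact h3.symm.trans h1

theorem odd_mod_iff {N a : ℕ} (hN : Even N) : Odd (a % N) ↔ Odd a :=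
  by
  conv_rhs => rw [← Nat.mod_add_div a N]
  rw [Nat.odd_add]
  simp [hN.mul_right]

theorem exists_leader {q m N s : ℕ} (hm : 1 ≤ m) (hN : N + 1 = q ^ m) (hq : Odd q)
    (hNe : Even N) (hs : s < N) (hodd : Odd s) :
    ∃ l ∈ oddLeaders q N, ∃ j, l * q ^ j ≡ s [MOD N] := by
  classical
  have hex : ∃ l, ∃ j, s * q ^ j % N = l := ⟨_, 0, rfl⟩
  obtain ⟨a, ha⟩ := Nat.find_spec hex
  have hmin : ∀ j, Nat.find hex ≤ s * q ^ j % N := fun j => Nat.find_min' hex ⟨j, rfl⟩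
  generalize Nat.find hex = l at ha hmin
  have hl : s * q ^ a ≡ l [MOD N] := by
    rw [← ha]; exact (Nat.mod_modEq _ _).symm
  refine ⟨l, mem_oddLeaders.2 ⟨?_, ?_, ?_⟩, (m - 1) * a, ?_⟩
  · rw [← ha]; exact Nat.mod_lt _ (by omega)
  · rw [← ha, odd_mod_iff hNe]
    exact hodd.mul hq.pow
  · intro j
    have h1 : l * q ^ j ≡ s * q ^ (a + j) [MOD N] := by
      rw [pow_add, ← mul_assoc]
      exact (hl.mul_right _).symm
    rw [h1]
    exact hmin _
  · exact (modEq_mul_pow_of_mul_pow_modEq hm hN hl).symm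

theorem leader_le_of_modEq {q m N l t a b : ℕ} (hm : 1 ≤ m) (hN : N + 1 = q ^ m)
    (hl : l ∈ oddLeaders q N) (h : l * q ^ a ≡ t * q ^ b [MOD N]) : l ≤ t := by
  have h1 := modEq_mul_pow_of_mul_pow_modEq hm hN h.symm
  rw [mul_assoc, ← pow_add] at h1
  calc l ≤ _ := (mem_oddLeaders.1 hl).2.2 (a + (m - 1) * b)
    _ = t % N := h1.symm
    _ ≤ t := Nat.mod_le _ _

/-- The cyclic shifts of a word with three ones whose gaps start with the smallest one are not
larger than the word itself. -/
theorem three_pow_shift_le {q m B C j : ℕ} (hq : 3 ≤ q) (hBm : B + 1 < m) (hCB : C < B)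
    (h1 : m - 1 - B ≤ B - C) (h2 : m - 1 - B < C + 1) (hj : j < m) :
    q ^ ((m - 1 + j) % m) + q ^ ((B + j) % m) + q ^ ((C + j) % m)
      ≤ q ^ (m - 1) + q ^ B + q ^ C := by
  have hq0 : 0 < q := by omega
  have key : ∀ x y z : ℕ, x < z → y < z → q ^ x + q ^ y ≤ q ^ z := by
    intro x y z hx hy
    obtain ⟨z, rfl⟩ : ∃ w, z = w + 1 := ⟨z - 1, by omega⟩
    have := Nat.pow_le_pow_right hq0 (show x ≤ z by omega)
    have := Nat.pow_le_pow_right hq0 (show y ≤ z by omega)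
    have := Nat.mul_le_mul_left (q ^ z) hq
    rw [pow_succ]
    omega
  have hmod : ∀ x, x < m → (x + j) % m = if x + j < m then x + j else x + j - m := by
    intro x hx
    split_ifs with h
    · exact Nat.mod_eq_of_lt h
    · rw [Nat.mod_eq_sub_mod (by omega), Nat.mod_eq_of_lt (by omega)]
  rcases Nat.eq_zero_or_pos j with rfl | hj0
  · simp [Nat.mod_eq_of_lt (show m - 1 < m by omega), Nat.mod_eq_of_lt (show B < m by omega),
      Nat.mod_eq_of_lt (show C < m by omega)]
  have hA : (m - 1 + j) % m = j - 1 := by rw [hmod _ (by omega)]; split_ifs <;> omega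
  rw [hA]
  by_cases hB : B + j = m - 1
  · have hB' : (B + j) % m = m - 1 := by rw [hmod _ (by omega)]; split_ifs <;> omega
    have hC' : (C + j) % m = C + j := by rw [hmod _ (by omega)]; split_ifs <;> omega
    rw [hB', hC']
    rcases Nat.lt_or_ge (C + j) B with h | h
    · have := key (j - 1) (C + j) B (by omega) h
      omega
    · have h' : C + j = B := by omega
      rw [h']
      have := Nat.pow_le_pow_right hq0 (show j - 1 ≤ C by omega)
      omega
  by_cases hC : C + j = m - 1
  · have hB' : (B + j) % m = B + j - m := by rw [hmod _ (by omega)]; split_ifs <;> omega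
    have hC' : (C + j) % m = m - 1 := by rw [hmod _ (by omega)]; split_ifs <;> omega
    rw [hB', hC']
    have hb : j - 1 < B := by omega
    have := key (j - 1) (B + j - m) B hb (by omega)
    omega
  · have hB' : (B + j) % m < m - 1 := by
      rw [hmod _ (by omega)]; split_ifs <;> omega
    have hC' : (C + j) % m < m - 1 := by
      rw [hmod _ (by omega)]; split_ifs <;> omega
    have e1 := Nat.pow_le_pow_right hq0 (show (B + j) % m ≤ m - 2 by omega)
    have e2 := Nat.pow_le_pow_right hq0 (show (C + j) % m ≤ m - 2 by omega)
    have e3 := Nat.pow_le_pow_right hq0 (show j - 1 ≤ m - 2 by omega)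
    have e4 : q ^ (m - 1) = q ^ (m - 2) * q := by
      rw [← pow_succ]; congr 1; omega
    have := Nat.mul_le_mul_left (q ^ (m - 2)) hq
    omega

/-- If every shift of `c` has a positive representative that is at most `c`, then `N - c` is the
least element of its coset. -/
theorem sub_mem_oddLeaders {q m N c : ℕ} (hN : N + 1 = q ^ m) (hNe : Even N) (hm : 1 ≤ m)
    (hc : c < N) (hodd : Odd c)
    (h : ∀ j < m, ∃ x, 0 < x ∧ x ≤ c ∧ c * q ^ j ≡ x [MOD N]) : N - c ∈ oddLeaders q N := by
  refine mem_oddLeaders.2 ⟨?_, ?_, ?_⟩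
  · have := hodd.pos
    omega
  · exact Nat.Even.sub_odd hc.le hNe hodd
  · intro j
    obtain ⟨x, hx0, hxc, hx⟩ := h (j % m) (Nat.mod_lt _ (by omega))
    have h1 : c * q ^ j ≡ x [MOD N] := ((pow_modEq_pow_mod hN j).mul_left c).trans hx
    have h2 : (N - c) * q ^ j ≡ N - x [MOD N] := by
      apply Nat.ModEq.add_right_cancel h1
      rw [← add_mul, Nat.sub_add_cancel hc.le, Nat.sub_add_cancel (by omega)]
      simp [Nat.ModEq]
    rw [h2, Nat.mod_eq_of_lt (by omega)]
    omega

theorem three_pow_mem_oddLeaders {q m N B C : ℕ} (hN : N + 1 = q ^ m) (hNe : Even N)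
    (hqo : Odd q) (hq : 3 ≤ q) (hBm : B + 1 < m) (hCB : C < B)
    (h1 : m - 1 - B ≤ B - C) (h2 : m - 1 - B < C + 1) :
    N - (q ^ (m - 1) + q ^ B + q ^ C) ∈ oddLeaders q N := by
  have hq0 : 0 < q := by omega
  have e1 : q ^ m = q ^ (m - 1) * q := by rw [← pow_succ]; congr 1; omega
  have e2 := Nat.pow_lt_pow_right (show 1 < q by omega) (show B < m - 1 by omega)
  have e3 := Nat.pow_lt_pow_right (show 1 < q by omega) (show C < m - 1 by omega)
  refine sub_mem_oddLeaders hN hNe (by omega) (by nlinarith) ?_ ?_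
  · exact (hqo.pow.add_odd hqo.pow).add_odd hqo.pow
  · intro j hj
    refine ⟨_, by positivity, three_pow_shift_le hq hBm hCB h1 h2 hj, ?_⟩
    rw [add_mul, add_mul, ← pow_add, ← pow_add, ← pow_add]
    exact ((pow_modEq_pow_mod hN _).add (pow_modEq_pow_mod hN _)).add (pow_modEq_pow_mod hN _)

theorem one_pow_mem_oddLeaders {q m N : ℕ} (hN : N + 1 = q ^ m) (hNe : Even N)
    (hqo : Odd q) (hq : 3 ≤ q) (hm : 2 ≤ m) :
    N - q ^ (m - 1) ∈ oddLeaders q N := by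
  have hq0 : 0 < q := by omega
  have e1 : q ^ m = q ^ (m - 1) * q := by rw [← pow_succ]; congr 1; omega
  have e2 := Nat.one_lt_pow (show m - 1 ≠ 0 by omega) (show 1 < q by omega)
  refine sub_mem_oddLeaders hN hNe (by omega) (by nlinarith) hqo.pow ?_
  intro j hj
  refine ⟨q ^ ((m - 1 + j) % m), by positivity, ?_, ?_⟩
  · apply Nat.pow_le_pow_right hq0
    have := Nat.mod_lt (m - 1 + j) (show 0 < m by omega)
    omega
  · rw [← pow_add]
    exact pow_modEq_pow_mod hN _

/-- If at most seven odd leaders are at least `d`, then each of them is close to `N`. -/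
theorem lt_add_of_card_filter_le {q k N d l : ℕ} (hN : N + 1 = q ^ (3 * k + 2)) (hNe : Even N)
    (hqo : Odd q) (hq : 3 ≤ q) (hk : 2 ≤ k)
    (hcard : ((oddLeaders q N).filter fun y => d ≤ y).card ≤ 7)
    (hl : l ∈ oddLeaders q N) (hdl : d ≤ l) :
    N < l + (q ^ (3 * k + 1) + q ^ (2 * k + 3)) := by
  by_contra! hcon
  have hq0 : 0 < q := by omega
  have hq1 : 1 < q := by omega
  have key : ∀ x y z : ℕ, x < z → y < z → q ^ x + q ^ y < q ^ z := by
    intro x y z hx hy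
    obtain ⟨z, rfl⟩ : ∃ w, z = w + 1 := ⟨z - 1, by omega⟩
    have := Nat.pow_le_pow_right hq0 (show x ≤ z by omega)
    have := Nat.pow_le_pow_right hq0 (show y ≤ z by omega)
    have : 0 < q ^ z := by positivity
    have := Nat.mul_le_mul_left (q ^ z) hq
    rw [pow_succ]
    omega
  have mem : ∀ B C, B < 3 * k + 1 → C < B → 3 * k + 1 - B ≤ B - C → 3 * k + 1 - B < C + 1 →
      N - (q ^ (3 * k + 1) + q ^ B + q ^ C) ∈ oddLeaders q N := by
    intro B C a b c e
    exact three_pow_mem_oddLeaders (m := 3 * k + 2) hN hNe hqo hq (by omega) b (by omega) (by omega)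
  have m0 : N - q ^ (3 * k + 1) ∈ oddLeaders q N :=
    one_pow_mem_oddLeaders (m := 3 * k + 2) hN hNe hqo hq (by omega)
  have m1 := mem (2 * k + 1) k (by omega) (by omega) (by omega) (by omega)
  have m2 := mem (2 * k + 1) (k + 1) (by omega) (by omega) (by omega) (by omega)
  have m3 := mem (2 * k + 2) (k - 1) (by omega) (by omega) (by omega) (by omega)
  have m4 := mem (2 * k + 2) k (by omega) (by omega) (by omega) (by omega)
  have m5 := mem (2 * k + 2) (k + 1) (by omega) (by omega) (by omega) (by omega)
  have m6 := mem (2 * k + 2) (k + 2) (by omega) (by omega) (by omega) (by omega)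
  have i1 : 0 < q ^ (k - 1) := by positivity
  have i2 := Nat.pow_lt_pow_right hq1 (show k - 1 < k by omega)
  have i3 := Nat.pow_lt_pow_right hq1 (show k < k + 1 by omega)
  have i4 := Nat.pow_lt_pow_right hq1 (show k + 1 < k + 2 by omega)
  have i5 := key (2 * k + 1) (k + 1) (2 * k + 2) (by omega) (by omega)
  have i6 := key (2 * k + 2) (k + 2) (2 * k + 3) (by omega) (by omega)
  generalize q ^ (3 * k + 1) = A at *
  generalize q ^ (2 * k + 3) = A₁ at *
  generalize q ^ (2 * k + 2) = A₂ at *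
  generalize q ^ (2 * k + 1) = A₃ at *
  generalize q ^ (k + 2) = A₄ at *
  generalize q ^ (k + 1) = A₅ at *
  generalize q ^ k = A₆ at *
  generalize q ^ (k - 1) = A₇ at *
  have hsub : ({l, N - A, N - (A + A₃ + A₆), N - (A + A₃ + A₅), N - (A + A₂ + A₇),
      N - (A + A₂ + A₆), N - (A + A₂ + A₅), N - (A + A₂ + A₄)} : Finset ℕ) ⊆
      (oddLeaders q N).filter fun y => d ≤ y := by
    intro x hx
    simp only [Finset.mem_insert, Finset.mem_singleton] at hx
    rw [Finset.mem_filter]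
    rcases hx with rfl | rfl | rfl | rfl | rfl | rfl | rfl | rfl <;>
      exact ⟨by assumption, by omega⟩
  have h8 := (Finset.card_le_card hsub).trans hcard
  iterate 7
    rw [Finset.card_insert_of_notMem (by
      simp only [Finset.mem_insert, Finset.mem_singleton]
      omega)] at h8
  simp at h8

/-- An odd leader with a coset of less than `m` elements is small. -/
theorem periodic_leader_add_le {q k N l e : ℕ} (hN : N + 1 = q ^ (3 * k + 2))
    (hqo : Odd q) (hq : 3 ≤ q) (hk : 2 ≤ k) (hl : l ∈ oddLeaders q N)
    (he : 0 < e) (hem : e < 3 * k + 2) (hper : l * q ^ e ≡ l [MOD N]) :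
    l + (q ^ (3 * k + 1) + q ^ (2 * k + 3)) ≤ N := by
  obtain ⟨hlN, hlo, hmin⟩ := mem_oddLeaders.1 hl
  have hq0 : 0 < q := by omega
  -- the period can be taken to divide `m`
  obtain ⟨d, r, hd, hr, hrd, hper⟩ : ∃ d r, 0 < d ∧ 1 < r ∧ d * r = 3 * k + 2 ∧
      l * q ^ d ≡ l [MOD N] := by
    have fper : ∀ a, Function.IsPeriodicPt (fun x : ZMod N => x * (q : ZMod N)) a (l : ZMod N) ↔
        l * q ^ a ≡ l [MOD N] := by
      intro a
      rw [Function.IsPeriodicPt, Function.IsFixedPt, mul_right_iterate,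
        ← ZMod.natCast_eq_natCast_iff]
      simp
    have h1 := (fper e).2 hper
    have h2 : l * q ^ (3 * k + 2) ≡ l [MOD N] := by
      simpa using (pow_mul_modEq_one hN 1).mul_left l
    have h3 := (fper _).1 (h1.gcd ((fper _).2 h2))
    obtain ⟨r, hr⟩ := Nat.gcd_dvd_right e (3 * k + 2)
    have hg : 0 < e.gcd (3 * k + 2) := Nat.gcd_pos_of_pos_left _ he
    have hge : e.gcd (3 * k + 2) ≤ e := Nat.gcd_le_left _ he
    refine ⟨_, r, hg, ?_, hr.symm, h3⟩
    by_contra! hr1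
    nlinarith
  set M := ∑ i ∈ range r, (q ^ d) ^ i with hM
  have hqd : 1 < q ^ d := Nat.one_lt_pow (by omega) (by omega)
  have hMN : M * (q ^ d - 1) = N := by
    rw [hM, Nat.geomSum_eq (by omega), Nat.div_mul_cancel]
    · rw [← pow_mul, hrd]; omega
    · simpa using Nat.sub_dvd_pow_sub_pow (q ^ d) 1 r
  obtain ⟨u, hu⟩ : M ∣ l := by
    have h1 : N ∣ l * q ^ d - l := (Nat.modEq_iff_dvd' (Nat.le_mul_of_pos_right _ (by omega))).1
      hper.symm
    have h2 : l * q ^ d - l = l * (q ^ d - 1) := by rw [Nat.mul_sub, mul_one]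
    rw [h2, ← hMN] at h1
    exact Nat.dvd_of_mul_dvd_mul_right (by omega) h1
  have hMo : Odd M := by
    rw [hu] at hlo
    exact (Nat.odd_mul.1 hlo).1
  have hro : Odd r := by
    rw [hM, Finset.odd_sum_iff_odd_card_odd] at hMo
    rwa [Finset.filter_true_of_mem (fun i _ => (hqo.pow).pow), Finset.card_range] at hMo
  have hr5 : 5 ≤ r := by
    obtain ⟨t, rfl⟩ := hro
    by_contra! h
    obtain rfl : t = 1 := by omega
    omega
  have hdk : d + 2 ≤ k := by
    by_contra! h
    have h1 : 5 * d ≤ 3 * k + 2 := by nlinarith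
    have hk3 : k ≤ 3 := by omega
    have hd2 : d ≤ 2 := by omega
    obtain ⟨t, rfl⟩ := hro
    interval_cases k <;> interval_cases d <;> omega
  -- the first digit of the complement is non-zero
  have hfirst : q ^ (3 * k + 1) ≤ N - l := by
    by_contra! h
    have h0 := hmin 1
    have e1 : q ^ (3 * k + 2) = q ^ (3 * k + 1) * q := pow_succ _ _
    have h2 : (N - l) * q < N := by nlinarith
    have h1 : l * q ^ 1 ≡ N - (N - l) * q [MOD N] := by
      apply Nat.ModEq.add_right_cancel (Nat.ModEq.refl ((N - l) * q))
      rw [pow_one, ← add_mul, Nat.sub_add_cancel h2.le, Nat.add_sub_cancel' hlN.le]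
      simp [Nat.ModEq]
    have h3 : 0 < N - l := by omega
    have h4 : N - l < (N - l) * q := by nlinarith
    rw [h1, Nat.mod_eq_of_lt (by omega)] at h0
    omega
  have hv : N - l = M * (q ^ d - 1 - u) := by rw [Nat.mul_sub, hMN, ← hu]
  set v := q ^ d - 1 - u with hvdef
  have e1 : q ^ (3 * k + 2) = q ^ (3 * k + 1) * q := pow_succ _ _
  have e2 : q ^ d = q ^ (d - 1) * q := by rw [← pow_succ]; congr 1; omega
  have hvq : q ^ (d - 1) ≤ v := by
    by_contra! h
    have h1 : q ^ (3 * k + 1) * (q ^ d - 1) ≤ N * v := by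
      calc _ ≤ (N - l) * (q ^ d - 1) := Nat.mul_le_mul_right _ hfirst
        _ = N * v := by rw [hv, ← hMN]; ring
    have h2 : N * v + N ≤ N * q ^ (d - 1) := by nlinarith
    have h3 : q ^ (3 * k + 1) * (q ^ d - 1) + q ^ (3 * k + 1) = q ^ (3 * k + 2) * q ^ (d - 1) := by
      rw [Nat.mul_sub, mul_one, Nat.sub_add_cancel (Nat.le_mul_of_pos_right _ (by omega)), e1, e2]
      ring
    have h4 : q ^ (3 * k + 1) < N := by
      have : 1 < q ^ (3 * k + 1) := Nat.one_lt_pow (by omega) (by omega)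
      nlinarith
    rw [← hN] at h3
    nlinarith
  have hMge : q ^ (d * (r - 1)) + q ^ (d * (r - 2)) ≤ M := by
    obtain ⟨r, rfl⟩ : ∃ x, r = x + 2 := ⟨r - 2, by omega⟩
    rw [hM, Finset.sum_range_succ, Finset.sum_range_succ, ← pow_mul, ← pow_mul]
    simp only [Nat.add_sub_cancel, show r + 2 - 1 = r + 1 by omega]
    omega
  have hfin : q ^ (3 * k + 1) + q ^ (2 * k + 3) ≤ N - l := by
    calc q ^ (3 * k + 1) + q ^ (2 * k + 3)
        ≤ q ^ (d * (r - 1) + (d - 1)) + q ^ (d * (r - 2) + (d - 1)) := by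
          obtain ⟨r, rfl⟩ : ∃ x, r = x + 2 := ⟨r - 2, by omega⟩
          simp only [Nat.add_sub_cancel, show r + 2 - 1 = r + 1 by omega]
          apply Nat.add_le_add <;> apply Nat.pow_le_pow_right hq0 <;>
            (ring_nf at hrd ⊢; omega)
      _ = (q ^ (d * (r - 1)) + q ^ (d * (r - 2))) * q ^ (d - 1) := by
          rw [pow_add, pow_add]; ring
      _ ≤ M * v := Nat.mul_le_mul hMge hvq
      _ = N - l := hv.symm
  omega

theorem mul_pow_mod_injOn_of_leader {q k N l : ℕ} (hN : N + 1 = q ^ (3 * k + 2)) (hNe : Even N)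
    (hqo : Odd q) (hq : 3 ≤ q) (hk : 2 ≤ k)
    (hcard : ((oddLeaders q N).filter fun y => l ≤ y).card ≤ 7)
    (hl : l ∈ oddLeaders q N) :
    Set.InjOn (fun j => l * q ^ j % N) (range (3 * k + 2)) := by
  have hcop : Nat.Coprime N q := by
    have h : Nat.Coprime N (q ^ (3 * k + 2)) := by rw [← hN]; simp
    exact (Nat.coprime_pow_right_iff (by omega) _ _).1 h
  have key : ∀ a b, a < b → b < 3 * k + 2 → ¬ l * q ^ a ≡ l * q ^ b [MOD N] := by
    intro a b hab hb h
    obtain ⟨e, rfl⟩ := Nat.exists_eq_add_of_lt hab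
    have h' : l * q ^ a ≡ l * q ^ (e + 1) * q ^ a [MOD N] := by
      rw [mul_assoc, ← pow_add]
      convert h using 3
      omega
    have h2 := Nat.ModEq.cancel_right_of_coprime (hcop.pow_right a) h'
    have h3 := periodic_leader_add_le hN hqo hq hk hl (Nat.succ_pos e) (by omega) h2.symm
    have h4 := lt_add_of_card_filter_le hN hNe hqo hq hk hcard hl le_rfl
    omega
  intro a ha b hb hab
  simp only [coe_range, Set.mem_Iio] at ha hb
  rcases lt_trichotomy a b with h | h | h
  · exact (key a b h hb hab).elim
  · exact h
  · exact (key b a h ha hab.symm).elim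

theorem mem_iUnion_qCoset {q N d s : ℕ} :
    (s : ZMod N) ∈ ⋃ t ∈ Set.Icc 1 d, qCoset q N t ↔
      ∃ t, 1 ≤ t ∧ t ≤ d ∧ ∃ j, t * q ^ j ≡ s [MOD N] := by
  simp only [qCoset, Set.mem_iUnion, Set.mem_range, Set.mem_Icc, ← ZMod.natCast_eq_natCast_iff]
  push_cast
  simp only [exists_prop, and_assoc]

open Classical in
theorem card_odd_notMem_iUnion_qCoset {q k N i d : ℕ} (hN : N + 1 = q ^ (3 * k + 2))
    (hNe : Even N) (hqo : Odd q) (hq : 3 ≤ q) (hk : 2 ≤ k) (hi : i ≤ 7)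
    (hd : IsIthLargest (oddLeaders q N) i d) :
    ((range N).filter fun s : ℕ => Odd s ∧
      (s : ZMod N) ∉ ⋃ t ∈ Set.Icc 1 (d - 2), qCoset q N t).card = i * (3 * k + 2) := by
  obtain ⟨hdL, hdc⟩ := hd
  have hdo := (mem_oddLeaders.1 hdL).2.1
  have hN0 : 0 < N := by have := (mem_oddLeaders.1 hdL).1; omega
  have heq : ((range N).filter fun s : ℕ => Odd s ∧
      (s : ZMod N) ∉ ⋃ t ∈ Set.Icc 1 (d - 2), qCoset q N t) =
      ((oddLeaders q N).filter fun y => d ≤ y).biUnion fun l =>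
        (range (3 * k + 2)).image fun j => l * q ^ j % N := by
    ext s
    simp only [mem_filter, mem_range, mem_biUnion, mem_image, mem_iUnion_qCoset]
    constructor
    · rintro ⟨hs, hso, hnot⟩
      obtain ⟨l, hl, j, hj⟩ := exists_leader (by omega) hN hqo hNe hs hso
      refine ⟨l, ⟨hl, ?_⟩, j % (3 * k + 2), Nat.mod_lt _ (by omega), ?_⟩
      · by_contra! hld
        have hlo := (mem_oddLeaders.1 hl).2.1
        refine hnot ⟨l, hlo.pos, ?_, j, hj⟩
        obtain ⟨a, rfl⟩ := hlo
        obtain ⟨b, rfl⟩ := hdo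
        omega
      · have h := ((pow_modEq_pow_mod hN j).mul_left l).symm.trans hj
        rw [h, Nat.mod_eq_of_lt hs]
    · rintro ⟨l, ⟨hl, hdl⟩, j, -, rfl⟩
      refine ⟨Nat.mod_lt _ hN0, ?_, ?_⟩
      · rw [odd_mod_iff hNe]
        exact (mem_oddLeaders.1 hl).2.1.mul hqo.pow
      · rintro ⟨t, ht1, ht2, a, ha⟩
        have := leader_le_of_modEq (by omega) hN hl ((ha.trans (Nat.mod_modEq _ _)).symm)
        omega
  rw [heq, card_biUnion]
  · rw [sum_congr rfl (g := fun _ => 3 * k + 2), sum_const, hdc, smul_eq_mul]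
    intro l hl
    rw [mem_filter] at hl
    rw [card_image_of_injOn, card_range]
    apply mul_pow_mod_injOn_of_leader hN hNe hqo hq hk _ hl.1
    refine le_trans (card_le_card ?_) (hdc.trans_le hi)
    intro y hy
    rw [mem_filter] at hy ⊢
    exact ⟨hy.1, hl.2.trans hy.2⟩
  · intro l hl l' hl' hne
    rw [mem_coe, mem_filter] at hl hl'
    rw [Function.onFun, disjoint_left]
    intro s hs hs'
    rw [mem_image] at hs hs'
    obtain ⟨a, -, rfl⟩ := hs
    obtain ⟨b, -, hb⟩ := hs'
    exact hne (le_antisymm (leader_le_of_modEq (by omega) hN hl.1 (Nat.ModEq.symm hb))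
      (leader_le_of_modEq (by omega) hN hl'.1 hb))

theorem three_le_of_isIthLargest {q k N i d : ℕ} (hN : N + 1 = q ^ (3 * k + 2))
    (hNe : Even N) (hqo : Odd q) (hq : 3 ≤ q) (hk : 2 ≤ k) (hi : i ≤ 7)
    (hd : IsIthLargest (oddLeaders q N) i d) : 3 ≤ d := by
  obtain ⟨hdL, hdc⟩ := hd
  have h := lt_add_of_card_filter_le hN hNe hqo hq hk (hdc.trans_le hi) hdL le_rfl
  have h1 : q ^ (3 * k + 2) = q ^ (3 * k + 1) * q := pow_succ _ _
  have h2 := Nat.mul_le_mul_left (q ^ (3 * k + 1)) hq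
  have h3 := Nat.pow_le_pow_right (show 0 < q by omega) (show 2 * k + 3 ≤ 3 * k + 1 by omega)
  have h4 := Nat.pow_le_pow_right (show 0 < q by omega) (show 1 ≤ 3 * k + 1 by omega)
  rw [pow_one] at h4
  omega

section Dimension

open Polynomial

variable {F E : Type*} [Field F] [Field E] [Algebra F E]

theorem evalAt_eq_aeval (n : ℕ) (x : E) (c : Fin n → F) :
    evalAt F n x c = aeval x ((degreeLTEquiv F n).symm c : F[X]) := by
  simp [evalAt, degreeLTEquiv, aeval_monomial, Algebra.smul_def]

theorem evalAt_pow_card [Fintype F] (n : ℕ) (x : E) (c : Fin n → F) :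
    evalAt F n (x ^ Fintype.card F) c = evalAt F n x c ^ Fintype.card F := by
  rw [evalAt_eq_aeval, evalAt_eq_aeval]
  exact aeval_algHom_apply (FiniteField.frobeniusAlgHom F E) x _

theorem mem_range_algebraMap_of_pow_card_eq [Fintype F] {x : E} (hx : x ^ Fintype.card F = x) :
    x ∈ Set.range (algebraMap F E) := by
  have hs : (X ^ Fintype.card F - X : F[X]).Splits := by
    rw [splits_iff_card_roots, FiniteField.roots_X_pow_card_sub_X, ← Finset.card_def,
      Finset.card_univ, FiniteField.X_pow_card_sub_X_natDegree_eq _ Fintype.one_lt_card]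
  have h := hs.roots_map (algebraMap F E)
  have hne := FiniteField.X_pow_card_sub_X_ne_zero E (Fintype.one_lt_card (α := F))
  have hmem : x ∈ ((X ^ Fintype.card F - X : F[X]).map (algebraMap F E)).roots := by
    simp [hne, hx]
  rw [h, Multiset.mem_map] at hmem
  obtain ⟨a, -, ha⟩ := hmem
  exact ⟨a, ha⟩

/-- A finite set of points that is stable under Frobenius is the zero set of a polynomial over the
base field with simple roots. -/
theorem exists_monic_map_eq_prod [Fintype F] (R : Finset E)
    (hR : ∀ x ∈ R, x ^ Fintype.card F ∈ R) :
    ∃ g : F[X], g.Monic ∧ g.natDegree = R.card ∧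
      g.map (algebraMap F E) = ∏ x ∈ R, (X - C x) := by
  classical
  let φ : E →+* E := (FiniteField.frobeniusAlgHom F E).toRingHom
  have hφ : ∀ x, φ x = x ^ Fintype.card F := fun x => rfl
  have himg : R.image φ = R := by
    apply Finset.eq_of_subset_of_card_le
    · intro y hy
      obtain ⟨x, hx, rfl⟩ := Finset.mem_image.1 hy
      exact hR x hx
    · rw [Finset.card_image_of_injective _ φ.injective]
  have hfix : (∏ x ∈ R, (X - C x)).map φ = ∏ x ∈ R, (X - C x) := by
    rw [Polynomial.map_prod]
    conv_rhs => rw [← himg, Finset.prod_image φ.injective.injOn]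
    simp
  have hlift : (∏ x ∈ R, (X - C x)) ∈ lifts (algebraMap F E) := by
    rw [lifts_iff_coeff_lifts]
    intro j
    apply mem_range_algebraMap_of_pow_card_eq
    rw [← hφ, ← coeff_map, hfix]
  obtain ⟨g, h1, h2, h3⟩ := lifts_and_natDegree_eq_and_monic hlift
    (monic_prod_of_monic _ _ fun x _ => monic_X_sub_C x)
  refine ⟨g, h3, ?_, h1⟩
  rw [h2, natDegree_prod_of_monic _ _ fun x _ => monic_X_sub_C x]
  simp

theorem finrank_iInf_ker_evalAt [Fintype F] (n : ℕ) (R : Finset E)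
    (hR : ∀ x ∈ R, x ^ Fintype.card F ∈ R) (hn : R.card ≤ n) :
    Module.finrank F ↥(⨅ x ∈ R, LinearMap.ker (evalAt F n x)) = n - R.card := by
  obtain ⟨g, hg, hdeg, hmap⟩ := exists_monic_map_eq_prod (F := F) R hR
  have hdvd : ∀ f : F[X], g ∣ f ↔ ∀ x ∈ R, aeval x f = 0 := by
    intro f
    rw [← map_dvd_map' (algebraMap F E), hmap]
    have hroot : ∀ x, X - C x ∣ f.map (algebraMap F E) ↔ aeval x f = 0 := by
      intro x
      rw [dvd_iff_isRoot, IsRoot.def, eval_map_algebraMap]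
    constructor
    · intro h x hx
      exact (hroot x).1 ((Finset.dvd_prod_of_mem (fun x : E => X - C x) hx).trans h)
    · intro h
      refine Finset.prod_dvd_of_coprime ?_ fun x hx => (hroot x).2 (h x hx)
      intro x _ y _ hxy
      exact isCoprime_X_sub_C_of_isUnit_sub (sub_ne_zero.2 hxy).isUnit
  let Ψ : (Fin n → F) →ₗ[F] F[X] :=
    modByMonicHom g ∘ₗ (degreeLT F n).subtype ∘ₗ (degreeLTEquiv F n).symm.toLinearMap
  have hΨ : ∀ c, Ψ c = ((degreeLTEquiv F n).symm c : F[X]) %ₘ g := fun c => rfl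
  have hker : (⨅ x ∈ R, LinearMap.ker (evalAt F n x)) = LinearMap.ker Ψ := by
    ext c
    simp only [Submodule.mem_iInf, LinearMap.mem_ker, hΨ, modByMonic_eq_zero_iff_dvd hg, hdvd,
      evalAt_eq_aeval]
  have hrange : LinearMap.range Ψ = degreeLT F R.card := by
    ext f
    rw [mem_degreeLT, LinearMap.mem_range, ← hdeg, ← degree_eq_natDegree hg.ne_zero]
    constructor
    · rintro ⟨c, rfl⟩
      exact degree_modByMonic_lt _ hg
    · intro hf
      have hfn : f ∈ degreeLT F n := by
        rw [mem_degreeLT]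
        refine hf.trans_le ?_
        rw [degree_eq_natDegree hg.ne_zero, hdeg]
        exact_mod_cast hn
      refine ⟨degreeLTEquiv F n ⟨f, hfn⟩, ?_⟩
      rw [hΨ, LinearEquiv.symm_apply_apply]
      exact (modByMonic_eq_self_iff hg).2 hf
  have h := LinearMap.finrank_range_add_finrank_ker Ψ
  rw [hrange, (degreeLTEquiv F R.card).finrank_eq, Module.finrank_fin_fun,
    Module.finrank_fin_fun] at h
  rw [hker]
  omega

theorem evalAt_pow_eq_zero_of_modEq [Fintype F] {n N s t j : ℕ} {γ : E} (hγ : γ ^ N = 1)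
    {c : Fin n → F} (h : t * Fintype.card F ^ j ≡ s [MOD N])
    (ht : evalAt F n (γ ^ t) c = 0) : evalAt F n (γ ^ s) c = 0 := by
  have hs : γ ^ s = γ ^ (t * Fintype.card F ^ j) := by
    rw [pow_eq_pow_mod s hγ, pow_eq_pow_mod (t * _) hγ, h]
  rw [hs]
  clear h hs
  induction j with
  | zero => simpa using ht
  | succ j ih =>
    rw [pow_succ, ← mul_assoc, pow_mul, evalAt_pow_card, ih, zero_pow Fintype.card_ne_zero]

open Classical in
theorem finrank_negaBCH [Fintype F] {n d : ℕ} {γ : E} (hγ : IsPrimitiveRoot γ (2 * n))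
    (hq : Odd (Fintype.card F)) (hd : Odd d) (hd3 : 3 ≤ d) (hdn : d < 2 * n) :
    Module.finrank F (negaBCH F n γ ((d + 1) / 2) 0) =
      ((range (2 * n)).filter fun s : ℕ => Odd s ∧
        (s : ZMod (2 * n)) ∉
          ⋃ t ∈ Set.Icc 1 (d - 2), qCoset (Fintype.card F) (2 * n) t).card := by
  set q := Fintype.card F with hqdef
  set P : ℕ → Prop := fun s =>
    (s : ZMod (2 * n)) ∈ ⋃ t ∈ Set.Icc 1 (d - 2), qCoset q (2 * n) t with hP
  have hPiff : ∀ s, P s ↔ ∃ t, 1 ≤ t ∧ t ≤ d - 2 ∧ ∃ j, t * q ^ j ≡ s [MOD 2 * n] :=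
    fun s => mem_iUnion_qCoset
  set T := ((range (2 * n)).filter Odd).filter P with hT
  have hmemT : ∀ s, s ∈ T ↔ (s < 2 * n ∧ Odd s) ∧ P s := by
    intro s
    rw [hT, mem_filter, mem_filter, mem_range]
  have hodds : ((range (2 * n)).filter Odd).card = n := by
    rw [show (range (2 * n)).filter Odd = (range n).image fun a => 2 * a + 1 by
      ext s
      simp only [mem_filter, mem_range, mem_image, Odd]
      constructor
      · rintro ⟨h, a, rfl⟩
        exact ⟨a, by omega, rfl⟩
      · rintro ⟨a, h, rfl⟩
        exact ⟨by omega, a, rfl⟩,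
      card_image_of_injective _ (fun a b h => by simpa using h), card_range]
  have hsplit := card_filter_add_card_filter_not (s := (range (2 * n)).filter Odd) P
  rw [← hT] at hsplit
  have hinj : Set.InjOn (fun s => γ ^ s) (T : Set ℕ) := by
    intro a ha b hb hab
    exact hγ.pow_inj ((hmemT a).1 ha).1.1 ((hmemT b).1 hb).1.1 hab
  have hcard : (T.image fun s => γ ^ s).card = T.card := card_image_of_injOn hinj
  have hcode : negaBCH F n γ ((d + 1) / 2) 0 =
      ⨅ x ∈ T.image fun s => γ ^ s, LinearMap.ker (evalAt F n x) := by
    ext c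
    simp only [negaBCH, Submodule.mem_iInf, LinearMap.mem_ker, mem_Icc, mem_image]
    obtain ⟨b, rfl⟩ := hd
    constructor
    · rintro h _ ⟨s, hs, rfl⟩
      obtain ⟨⟨hsn, hso⟩, hsP⟩ := (hmemT s).1 hs
      obtain ⟨t, ht1, ht2, j, hj⟩ := (hPiff s).1 hsP
      have hto : Odd t := by
        rw [← Nat.mod_eq_of_lt hsn, ← hj, odd_mod_iff (even_two_mul n)] at hso
        exact (Nat.odd_mul.1 hso).1
      obtain ⟨a, rfl⟩ := hto
      refine evalAt_pow_eq_zero_of_modEq hγ.pow_eq_one hj ?_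
      rw [add_comm]
      exact h a ⟨by omega, by omega⟩
    · intro h a ha
      refine h _ ⟨1 + 2 * a, (hmemT _).2 ⟨⟨by omega, a, by omega⟩, (hPiff _).2 ?_⟩, rfl⟩
      exact ⟨1 + 2 * a, by omega, by omega, 0, by simp [Nat.ModEq]⟩
  rw [hcode, finrank_iInf_ker_evalAt, hcard, ← filter_filter]
  · change n - T.card = (((range (2 * n)).filter Odd).filter fun s => ¬ P s).card
    omega
  · intro x hx
    obtain ⟨s, hs, rfl⟩ := mem_image.1 hx
    obtain ⟨⟨hsn, hso⟩, hsP⟩ := (hmemT s).1 hs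
    obtain ⟨t, ht1, ht2, j, hj⟩ := (hPiff s).1 hsP
    refine mem_image.2 ⟨s * q % (2 * n), (hmemT _).2 ⟨⟨Nat.mod_lt _ (by omega), ?_⟩,
      (hPiff _).2 ⟨t, ht1, ht2, j + 1, ?_⟩⟩, ?_⟩
    · rw [odd_mod_iff (even_two_mul n)]
      exact hso.mul hq
    · rw [pow_succ, ← mul_assoc]
      exact (hj.mul_right q).trans (Nat.mod_modEq _ _).symm
    · rw [← pow_mul]
      exact (pow_eq_pow_mod _ hγ.pow_eq_one).symm
  · omega

end Dimension

theorem stmt_6 (q m n i δ' : ℕ)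
    (hq : ∃ p e : ℕ, p.Prime ∧ Odd p ∧ 0 < e ∧ q = p ^ e)
    (hq3 : 3 ≤ q) (hm : 8 ≤ m) (hm3 : m % 3 = 2) (hn : 2 * n = q ^ m - 1)
    (hi1 : 1 ≤ i) (hi2 : i ≤ 7)
    (hδ' : IsIthLargest (oddLeaders q (2 * n)) i δ')
    (F E : Type*) [Field F] [Fintype F] [Field E] [Algebra F E]
    (hF : Fintype.card F = q)
    (γ : E) (hγ : IsPrimitiveRoot γ (2 * n)) :
    Module.finrank F (negaBCH F n γ ((δ' + 1) / 2) 0) = i * m ∧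
    {s : ℕ | 1 ≤ s ∧ s ≤ 2 * n - 1 ∧ Odd s ∧
      (s : ZMod (2 * n)) ∉ ⋃ t ∈ Set.Icc 1 (δ' - 2), qCoset q (2 * n) t}.ncard = i * m := by
  classical
  obtain ⟨p, e, -, hp, -, hqp⟩ := hq
  have hqo : Odd q := hqp ▸ hp.pow
  obtain ⟨k, rfl⟩ : ∃ k, m = 3 * k + 2 := ⟨m / 3, by omega⟩
  have hN : 2 * n + 1 = q ^ (3 * k + 2) := by
    have : 0 < q ^ (3 * k + 2) := by positivity
    omega
  have hk : 2 ≤ k := by omega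
  have hcard := card_odd_notMem_iUnion_qCoset hN (even_two_mul n) hqo hq3 hk hi2 hδ'
  have h3 := three_le_of_isIthLargest hN (even_two_mul n) hqo hq3 hk hi2 hδ'
  obtain ⟨hlt, hodd, -⟩ := mem_oddLeaders.1 hδ'.1
  constructor
  · have h := finrank_negaBCH (F := F) hγ (hF ▸ hqo) hodd h3 hlt
    rw [hF] at h
    exact h.trans hcard
  · rw [← hcard, ← Set.ncard_coe_finset]
    refine congrArg Set.ncard ?_
    ext s
    simp only [Set.mem_ofPred_eq, coe_filter, mem_range]
    constructor
    · rintro ⟨h1, h2, h⟩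
      exact ⟨by omega, h⟩
    · rintro ⟨h1, h⟩
      exact ⟨h.1.pos, by omega, h⟩
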